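/- arXiv:2511.16875 — 2 statements merged into one kernel-verified Lean document; each statement's English description precedes it below -/
import Mathlib

section
/- Let V be a real vector space, let G be a finite group acting on V by ℝ-linear automorphisms, and let Λ ⊆ V be a countable additive subgroup that is invariant under the action of every element of G (so the action of G descends to an action on the quotient group V/Λ). Assume that the only vector of V fixed by every element of G is 0. Then the set of elements of V/Λ that are fixed by every element of G is countable. -/
/-- If a representation of a finite group has no nonzero fixed vector, then only countably many
vectors are moved by elements of a given countable set under every group element. -/
theorem Representation.countable_setOf_sub_mem {k G V : Type*} [Ring k] [AddCommGroup V]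
    [Module k V] [Group G] [Finite G] (ρ : Representation k G V) {s : Set V} (hs : s.Countable)
    (hfix : ∀ v : V, (∀ g : G, ρ g v = v) → v = 0) :
    {v : V | ∀ g : G, ρ g v - v ∈ s}.Countable := by
  have hinj : Function.Injective fun (v : V) (g : G) => ρ g v - v := by
    intro v w h
    refine sub_eq_zero.mp (hfix _ fun g => ?_)
    have hg : ρ g v - v = ρ g w - w := congrFun h g
    rw [map_sub, sub_eq_sub_iff_sub_eq_sub.mp hg]
  exact Set.MapsTo.countable_of_injOn (t := Set.univ.pi fun _ : G => s)
    (fun v hv g _ => hv g) hinj.injOn (Set.countable_univ_pi fun _ => hs)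

/-- If a finite group `G` acts `ℝ`-linearly on a real vector space `V`, `Λ ⊆ V` is a countable
`G`-invariant additive subgroup, and the only `G`-fixed vector of `V` is `0`, then the set of
`G`-fixed elements of `V ⧸ Λ` is countable. An element `q : V ⧸ Λ` is fixed by the descended
action of `g` exactly when `ρ g v - v ∈ Λ` for every lift `v` of `q`. -/
theorem stmt_2 (V : Type*) [AddCommGroup V] [Module ℝ V]
    (G : Type*) [Group G] [Finite G]
    (ρ : Representation ℝ G V)
    (Λ : AddSubgroup V)
    (hΛcount : (Λ : Set V).Countable)
    (hΛinv : ∀ (g : G), ∀ v ∈ Λ, ρ g v ∈ Λ)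
    (hfix : ∀ v : V, (∀ g : G, ρ g v = v) → v = 0) :
    {q : V ⧸ Λ | ∀ (g : G) (v : V), QuotientAddGroup.mk v = q → ρ g v - v ∈ Λ}.Countable := by
  refine ((ρ.countable_setOf_sub_mem hΛcount hfix).image (QuotientAddGroup.mk : V → V ⧸ Λ)).mono ?_
  intro q hq
  obtain ⟨v, rfl⟩ := QuotientAddGroup.mk_surjective q
  exact ⟨v, fun g => hq g v rfl, rfl⟩
end

section
/- Let V be a finite-dimensional real vector space with its standard topology, let Λ ⊆ V be a ℤ-lattice (a discrete additive subgroup of V whose ℝ-span is all of V), so that the quotient V/Λ with the quotient topology is a compact torus. Let G be a finite group acting on V by ℝ-linear automorphisms such that each g ∈ G maps Λ into Λ, so the action descends to an action on V/Λ by continuous automorphisms. Assume that the only vector of V fixed by every element of G is 0. Then the set of elements of V/Λ fixed by every element of G is finite. -/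
/-- Averaging: if no nonzero vector is fixed by `G` and every `g` moves `v` by an element of `Λ`,
then `|G| • v` lies in `Λ`. -/
theorem card_nsmul_mem_of_sub_mem {k V G : Type*} [CommRing k] [AddCommGroup V] [Module k V]
    [Group G] (ρ : Representation k G V) (Λ : AddSubgroup V)
    (hfix : ∀ v : V, (∀ g : G, ρ g v = v) → v = 0) {v : V} (hv : ∀ g : G, ρ g v - v ∈ Λ) :
    Nat.card G • v ∈ Λ := by
  obtain hG | hG := finite_or_infinite G
  · have := Fintype.ofFinite G
    have hsum : ∑ g : G, ρ g v = 0 := by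
      refine hfix _ fun h => ?_
      rw [map_sum]
      exact Fintype.sum_equiv (Equiv.mulLeft h) _ _ fun g => by simp
    have hmem : ∑ g : G, (ρ g v - v) ∈ Λ := sum_mem fun g _ => hv g
    simpa [Finset.sum_sub_distrib, hsum] using hmem
  · simp

/-- The `n`-torsion of the quotient of a real vector space by a finitely generated subgroup
is finite. -/
theorem finite_setOf_nsmul_eq_zero {V : Type*} [AddCommGroup V] [Module ℝ V] (Λ : AddSubgroup V)
    [Module.Finite ℤ Λ] {n : ℕ} (hn : n ≠ 0) : {q : V ⧸ Λ | n • q = 0}.Finite := by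
  have hn' : (n : ℝ) ≠ 0 := Nat.cast_ne_zero.mpr hn
  let f : Λ →+ V ⧸ Λ := (QuotientAddGroup.mk' Λ).comp
    ((DistribSMul.toAddMonoidHom V (n : ℝ)⁻¹).comp Λ.subtype)
  have hf (x : Λ) : n • f x = 0 := by
    have : n • ((n : ℝ)⁻¹ • (x : V)) = x := by
      rw [← Nat.cast_smul_eq_nsmul ℝ, smul_inv_smul₀ hn']
    change ((n • ((n : ℝ)⁻¹ • (x : V)) : V) : V ⧸ Λ) = 0
    rw [this]
    exact (QuotientAddGroup.eq_zero_iff _).mpr x.2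
  have : Module.Finite ℤ f.range :=
    Module.Finite.of_surjective f.rangeRestrict.toIntLinearMap f.rangeRestrict_surjective
  have : AddGroup.FG f.range := Module.Finite.iff_addGroup_fg.mp this
  have : Finite f.range := AddCommGroup.finite_of_fg_isAddTorsion _ <| by
    rintro ⟨_, x, rfl⟩
    exact isOfFinAddOrder_iff_nsmul_eq_zero.mpr
      ⟨n, Nat.pos_of_ne_zero hn, Subtype.ext (hf x)⟩
  refine (Set.toFinite (f.range : Set (V ⧸ Λ))).subset fun q hq => ?_
  obtain ⟨v, rfl⟩ := QuotientAddGroup.mk_surjective q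
  refine ⟨⟨n • v, (QuotientAddGroup.eq_zero_iff _).mp hq⟩, ?_⟩
  change (((n : ℝ)⁻¹ • (n • v) : V) : V ⧸ Λ) = v
  rw [← Nat.cast_smul_eq_nsmul ℝ, inv_smul_smul₀ hn']

/-- If a finite group `G` acts `ℝ`-linearly on a finite-dimensional real vector space `V`
(with its standard topology), `Λ ⊆ V` is a lattice (a discrete additive subgroup whose `ℝ`-span
is all of `V`) mapped into itself by every `g ∈ G`, and the only `G`-fixed vector of `V` is `0`,
then the set of `G`-fixed elements of the compact torus `V ⧸ Λ` is finite. An element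
`q : V ⧸ Λ` is fixed by the descended action of `g` exactly when `ρ g v - v ∈ Λ` for every
lift `v` of `q`. -/
theorem stmt_3 (V : Type*) [NormedAddCommGroup V] [NormedSpace ℝ V] [FiniteDimensional ℝ V]
    (G : Type*) [Group G] [Finite G]
    (ρ : Representation ℝ G V)
    (Λ : AddSubgroup V) [DiscreteTopology Λ]
    (hΛspan : Submodule.span ℝ (Λ : Set V) = ⊤)
    (hΛinv : ∀ (g : G), ∀ v ∈ Λ, ρ g v ∈ Λ)
    (hfix : ∀ v : V, (∀ g : G, ρ g v = v) → v = 0) :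
    {q : V ⧸ Λ | ∀ (g : G) (v : V), QuotientAddGroup.mk v = q → ρ g v - v ∈ Λ}.Finite := by
  have : DiscreteTopology (AddSubgroup.toIntSubmodule Λ) := inferInstanceAs (DiscreteTopology Λ)
  have : Module.Finite ℤ Λ := instModuleFinite_of_discrete_submodule (AddSubgroup.toIntSubmodule Λ)
  refine (finite_setOf_nsmul_eq_zero Λ (Nat.card_pos (α := G)).ne').subset fun q hq => ?_
  obtain ⟨v, rfl⟩ := QuotientAddGroup.mk_surjective q
  exact (QuotientAddGroup.eq_zero_iff _).mpr
    (card_nsmul_mem_of_sub_mem ρ Λ hfix fun g => hq g v rfl)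
end
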